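/- arXiv:0712.0554 — 3 statements merged into one kernel-verified Lean document; each statement's English description precedes it below -/
import Mathlib

section
/- For every integer d ≥ 1 and every real s > 0, there exists a constant C (depending only on d and s) such that every set S of n ≥ 2 points in ℝ^d admits a well-separated pair decomposition with separation constant s consisting of at most C·n·log₂ n pairs in which every pair {X, Y} satisfies |X| = 1 or |Y| = 1. -/
/-- The axes-parallel bounding box of a set `X ⊆ ℝ^d`: the smallest
axes-parallel hyperrectangle containing `X`, described coordinatewise via the
infimum and supremum of each coordinate over `X`. -/
def boundingBox {d : ℕ} (X : Set (EuclideanSpace ℝ (Fin d))) :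
    Set (EuclideanSpace ℝ (Fin d)) :=
  {p | ∀ i : Fin d, sInf ((fun x => x i) '' X) ≤ p i ∧ p i ≤ sSup ((fun x => x i) '' X)}

/-- `X` and `Y` are well-separated with respect to `s`: there are two closed
balls of the same radius `ρ`, one containing the bounding box of `X`, the other
containing the bounding box of `Y`, at distance at least `s·ρ` from each other. -/
def WellSeparated {d : ℕ} (s : ℝ) (X Y : Set (EuclideanSpace ℝ (Fin d))) : Prop :=
  ∃ (c₁ c₂ : EuclideanSpace ℝ (Fin d)) (ρ : ℝ), 0 ≤ ρ ∧
    boundingBox X ⊆ Metric.closedBall c₁ ρ ∧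
    boundingBox Y ⊆ Metric.closedBall c₂ ρ ∧
    ∀ x ∈ Metric.closedBall c₁ ρ, ∀ y ∈ Metric.closedBall c₂ ρ, s * ρ ≤ dist x y

/-- A well-separated pair decomposition of a finite set `S ⊆ ℝ^d` with
separation constant `s`: a finite set of unordered pairs `{X, Y}` of nonempty
subsets of `S`, each pair well-separated with respect to `s`, such that for
every two distinct points `p, q ∈ S` there is exactly one pair `{X, Y}` of the
collection with `p ∈ X` and `q ∈ Y`. -/
def IsWSPD {d : ℕ} (s : ℝ) (S : Finset (EuclideanSpace ℝ (Fin d)))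
    (W : Finset (Sym2 (Set (EuclideanSpace ℝ (Fin d))))) : Prop :=
  (∀ e ∈ W, ∀ X Y : Set (EuclideanSpace ℝ (Fin d)), e = s(X, Y) →
      X.Nonempty ∧ Y.Nonempty ∧ X ⊆ ↑S ∧ Y ⊆ ↑S ∧ WellSeparated s X Y) ∧
  (∀ p ∈ S, ∀ q ∈ S, p ≠ q →
      ∃! e, e ∈ W ∧ ∃ X Y : Set (EuclideanSpace ℝ (Fin d)),
        e = s(X, Y) ∧ p ∈ X ∧ q ∈ Y)

/-- The index of the cell of the axes-parallel grid of mesh `2 ^ l` containing `p`. -/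
noncomputable def gridIndex {d : ℕ} (l : ℤ) (p : EuclideanSpace ℝ (Fin d)) : Fin d → ℤ :=
  fun i => ⌊p i / 2 ^ l⌋

/-- The points of `S` in the cell with index `a` of the grid of mesh `2 ^ l`. -/
def gridCell {d : ℕ} (S : Finset (EuclideanSpace ℝ (Fin d))) (l : ℤ) (a : Fin d → ℤ) :
    Set (EuclideanSpace ℝ (Fin d)) :=
  {x | x ∈ S ∧ gridIndex l x = a}

/-- Two grid cells are far apart if some coordinates of their indices differ by more than `K`. -/
def IndexFar {d : ℕ} (K : ℕ) (a b : Fin d → ℤ) : Prop :=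
  ∃ i, (K : ℤ) < |a i - b i|

/-- The mesh `2 ^ l` is the coarsest one at which the cells of `p` and `q` are far apart. -/
def IsSepLevel {d : ℕ} (K : ℕ) (l : ℤ) (p q : EuclideanSpace ℝ (Fin d)) : Prop :=
  IndexFar K (gridIndex l p) (gridIndex l q) ∧
    ¬ IndexFar K (gridIndex (l + 1) p) (gridIndex (l + 1) q)

/-- The coarsest level at which the cells of `p` and `q` are far apart. -/
noncomputable def sepLevel {d : ℕ} (K : ℕ) (p q : EuclideanSpace ℝ (Fin d)) : ℤ :=
  Classical.epsilon fun l => IsSepLevel K l p q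

open Classical in
/-- The number of points of `S` in the cells equal or adjacent to the cell with index `a`. -/
noncomputable def nearCount {d : ℕ} (S : Finset (EuclideanSpace ℝ (Fin d))) (l : ℤ)
    (a : Fin d → ℤ) : ℕ :=
  (S.filter fun x => ∀ i, |gridIndex l x i - a i| ≤ 1).card

/-- A strict linear order on grid cells refining the comparison of `nearCount`. -/
def Lighter {d : ℕ} (S : Finset (EuclideanSpace ℝ (Fin d))) (l : ℤ)
    (a b : Fin d → ℤ) : Prop :=
  nearCount S l a < nearCount S l b ∨
    (nearCount S l a = nearCount S l b ∧ toLex a < toLex b)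

/-- The pair formed by `p` and the cell of `q` at the separation level of `p` and `q`. -/
noncomputable def cellPair {d : ℕ} (K : ℕ) (S : Finset (EuclideanSpace ℝ (Fin d)))
    (p q : EuclideanSpace ℝ (Fin d)) : Sym2 (Set (EuclideanSpace ℝ (Fin d))) :=
  s({p}, gridCell S (sepLevel K p q) (gridIndex (sepLevel K p q) q))

/-- The cell of `p` is lighter than the cell of `q` at the separation level. -/
def Pays {d : ℕ} (K : ℕ) (S : Finset (EuclideanSpace ℝ (Fin d)))
    (p q : EuclideanSpace ℝ (Fin d)) : Prop :=
  Lighter S (sepLevel K p q) (gridIndex (sepLevel K p q) p) (gridIndex (sepLevel K p q) q)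

open Classical in
/-- The decomposition into pairs formed by a point and a cell. -/
noncomputable def singletonDecomposition {d : ℕ} (K : ℕ)
    (S : Finset (EuclideanSpace ℝ (Fin d))) : Finset (Sym2 (Set (EuclideanSpace ℝ (Fin d)))) :=
  ((S ×ˢ S).filter fun z => z.1 ≠ z.2 ∧ Pays K S z.1 z.2).image fun z => cellPair K S z.1 z.2

lemma mem_singletonDecomposition {d : ℕ} {K : ℕ} {S : Finset (EuclideanSpace ℝ (Fin d))}
    {e : Sym2 (Set (EuclideanSpace ℝ (Fin d)))} :
    e ∈ singletonDecomposition K S ↔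
      ∃ p ∈ S, ∃ q ∈ S, p ≠ q ∧ Pays K S p q ∧ e = cellPair K S p q := by
  simp only [singletonDecomposition, Finset.mem_image, Finset.mem_filter, Finset.mem_product,
    Prod.exists]
  constructor
  · rintro ⟨p, q, ⟨⟨hp, hq⟩, hne, hpay⟩, rfl⟩
    exact ⟨p, hp, q, hq, hne, hpay, rfl⟩
  · rintro ⟨p, hp, q, hq, hne, hpay, rfl⟩
    exact ⟨p, q, ⟨⟨hp, hq⟩, hne, hpay⟩, rfl⟩

section Grid

variable {d : ℕ}

lemma gridIndex_add_natCast (l : ℤ) (c : ℕ) (p : EuclideanSpace ℝ (Fin d)) (i : Fin d) :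
    gridIndex (l + c) p i = gridIndex l p i / 2 ^ c := by
  have h : p i / 2 ^ (l + c) = p i / 2 ^ l / ((2 ^ c : ℕ) : ℝ) := by
    rw [zpow_add₀ (by norm_num), div_div]
    push_cast
    rw [zpow_natCast]
  simp only [gridIndex]
  rw [h, Int.floor_div_natCast]
  push_cast
  rfl

lemma gridIndex_add_one (l : ℤ) (p : EuclideanSpace ℝ (Fin d)) (i : Fin d) :
    gridIndex (l + 1) p i = gridIndex l p i / 2 := by
  simpa using gridIndex_add_natCast l 1 p i

lemma IndexFar.symm {K : ℕ} {a b : Fin d → ℤ} (h : IndexFar K a b) : IndexFar K b a := by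
  obtain ⟨i, hi⟩ := h
  exact ⟨i, by rwa [abs_sub_comm]⟩

lemma indexFar_comm {K : ℕ} {a b : Fin d → ℤ} : IndexFar K a b ↔ IndexFar K b a :=
  ⟨IndexFar.symm, IndexFar.symm⟩

lemma isSepLevel_comm {K : ℕ} {l : ℤ} {p q : EuclideanSpace ℝ (Fin d)} :
    IsSepLevel K l p q ↔ IsSepLevel K l q p := by
  simp only [IsSepLevel]
  rw [indexFar_comm, indexFar_comm (a := gridIndex (l + 1) p)]

lemma IsSepLevel.congr {K : ℕ} {l : ℤ} {p q q' : EuclideanSpace ℝ (Fin d)}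
    (h : IsSepLevel K l p q) (hq : gridIndex l q' = gridIndex l q) : IsSepLevel K l p q' := by
  have h' : gridIndex (l + 1) q' = gridIndex (l + 1) q := by
    funext i
    rw [gridIndex_add_one, gridIndex_add_one, hq]
  rw [IsSepLevel, hq, h']
  exact h

lemma indexFar_of_add_one {K : ℕ} {l : ℤ} {p q : EuclideanSpace ℝ (Fin d)}
    (h : IndexFar K (gridIndex (l + 1) p) (gridIndex (l + 1) q)) :
    IndexFar K (gridIndex l p) (gridIndex l q) := by
  obtain ⟨i, hi⟩ := h
  refine ⟨i, ?_⟩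
  rw [gridIndex_add_one, gridIndex_add_one] at hi
  rw [lt_abs] at hi ⊢
  omega

lemma indexFar_of_le {K : ℕ} {l l' : ℤ} (hl : l ≤ l') {p q : EuclideanSpace ℝ (Fin d)}
    (h : IndexFar K (gridIndex l' p) (gridIndex l' q)) :
    IndexFar K (gridIndex l p) (gridIndex l q) := by
  induction l', hl using Int.leInduction with
  | base => exact h
  | succ n _ ih => exact ih (indexFar_of_add_one h)

lemma IsSepLevel.unique {K : ℕ} {l l' : ℤ} {p q : EuclideanSpace ℝ (Fin d)}
    (h : IsSepLevel K l p q) (h' : IsSepLevel K l' p q) : l = l' := by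
  by_contra hne
  rcases lt_or_gt_of_ne hne with hlt | hlt
  · exact h.2 (indexFar_of_le (by omega) h'.1)
  · exact h'.2 (indexFar_of_le (by omega) h.1)

lemma exists_isSepLevel {K : ℕ} (hK : 1 ≤ K) {p q : EuclideanSpace ℝ (Fin d)} (hpq : p ≠ q) :
    ∃ l, IsSepLevel K l p q := by
  obtain ⟨i, hi⟩ : ∃ i, p i ≠ q i := by
    by_contra! h
    exact hpq (PiLp.ext h)
  have hKr : (1 : ℝ) ≤ K := by exact_mod_cast hK
  have hbdd : ∃ b : ℤ, ∀ z, IndexFar K (gridIndex z p) (gridIndex z q) → z ≤ b := by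
    obtain ⟨m, hm⟩ := pow_unbounded_of_one_lt (dist p q) (one_lt_two (α := ℝ))
    refine ⟨m, fun z ⟨j, hj⟩ => ?_⟩
    by_contra! hz
    have hj' : (K : ℝ) + 1 ≤ |(⌊p j / 2 ^ z⌋ : ℝ) - ⌊q j / 2 ^ z⌋| := by
      exact_mod_cast hj
    have hpz : (0 : ℝ) < 2 ^ z := by positivity
    have hmz : (2 : ℝ) ^ m ≤ 2 ^ z := by
      rw [← zpow_natCast]
      exact zpow_le_zpow_right₀ (by norm_num) hz.le
    have hd : |p j - q j| ≤ dist p q := by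
      rw [dist_eq_norm]
      exact PiLp.norm_apply_le (p - q) j
    have hdiv : |p j / 2 ^ z - q j / 2 ^ z| < 1 := by
      rw [← sub_div, abs_div, abs_of_pos hpz, div_lt_one hpz]
      linarith
    have h1 := Int.floor_le (p j / 2 ^ z)
    have h2 := Int.lt_floor_add_one (p j / 2 ^ z)
    have h3 := Int.floor_le (q j / 2 ^ z)
    have h4 := Int.lt_floor_add_one (q j / 2 ^ z)
    rw [abs_lt] at hdiv
    rw [le_abs] at hj'
    rcases hj' with hj' | hj' <;> linarith
  have hex : ∃ z, IndexFar K (gridIndex z p) (gridIndex z q) := by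
    have hpos : 0 < |p i - q i| := abs_pos.mpr (sub_ne_zero.mpr hi)
    obtain ⟨m, hm⟩ := pow_unbounded_of_one_lt (((K : ℝ) + 1) / |p i - q i|)
      (one_lt_two (α := ℝ))
    rw [div_lt_iff₀ hpos] at hm
    refine ⟨-m, i, ?_⟩
    have hx : ∀ x : ℝ, x / 2 ^ (-(m : ℤ)) = x * 2 ^ m := fun x => by
      rw [zpow_neg, zpow_natCast, div_inv_eq_mul]
    simp only [gridIndex, hx]
    have hm' : (K : ℝ) + 1 < |p i * 2 ^ m - q i * 2 ^ m| := by
      rw [← sub_mul, abs_mul, abs_of_pos (pow_pos (two_pos (α := ℝ)) m)]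
      linarith
    have h1 := Int.floor_le (p i * 2 ^ m)
    have h2 := Int.lt_floor_add_one (p i * 2 ^ m)
    have h3 := Int.floor_le (q i * 2 ^ m)
    have h4 := Int.lt_floor_add_one (q i * 2 ^ m)
    rw [← Int.cast_lt (R := ℝ)]
    push_cast
    rw [lt_abs] at hm' ⊢
    rcases hm' with hm' | hm'
    · left; linarith
    · right; linarith
  obtain ⟨l, hl, hmax⟩ := Int.exists_greatest_of_bdd hbdd hex
  exact ⟨l, hl, fun h => by linarith [hmax _ h]⟩

lemma isSepLevel_sepLevel {K : ℕ} (hK : 1 ≤ K) {p q : EuclideanSpace ℝ (Fin d)} (hpq : p ≠ q) :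
    IsSepLevel K (sepLevel K p q) p q :=
  Classical.epsilon_spec (exists_isSepLevel hK hpq)

lemma IsSepLevel.sepLevel_eq {K : ℕ} {l : ℤ} {p q : EuclideanSpace ℝ (Fin d)}
    (h : IsSepLevel K l p q) : sepLevel K p q = l :=
  (Classical.epsilon_spec (p := fun l => IsSepLevel K l p q) ⟨l, h⟩).unique h

lemma sepLevel_comm (K : ℕ) (p q : EuclideanSpace ℝ (Fin d)) :
    sepLevel K p q = sepLevel K q p := by
  simp only [sepLevel, isSepLevel_comm (p := p)]

lemma sepLevel_eq_of_gridIndex_eq {K : ℕ} (hK : 1 ≤ K) {p q q' : EuclideanSpace ℝ (Fin d)}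
    (hpq : p ≠ q)
    (hq : gridIndex (sepLevel K p q) q' = gridIndex (sepLevel K p q) q) :
    sepLevel K p q' = sepLevel K p q :=
  ((isSepLevel_sepLevel hK hpq).congr hq).sepLevel_eq

lemma boundingBox_gridCell_subset {S : Finset (EuclideanSpace ℝ (Fin d))} {l : ℤ}
    {a : Fin d → ℤ} {X : Set (EuclideanSpace ℝ (Fin d))} (hX : X.Nonempty)
    (hXa : X ⊆ gridCell S l a) :
    boundingBox X ⊆
      Metric.closedBall (WithLp.toLp 2 fun i => (a i : ℝ) * 2 ^ l) (d * 2 ^ l) := by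
  intro p hp
  have hh : (0 : ℝ) < 2 ^ l := by positivity
  have hmem : ∀ x ∈ X, ∀ i, (a i : ℝ) * 2 ^ l ≤ x i ∧ x i ≤ (a i : ℝ) * 2 ^ l + 2 ^ l := by
    intro x hx i
    have hxa : ⌊x i / 2 ^ l⌋ = a i := congrFun (hXa hx).2 i
    rw [Int.floor_eq_iff, le_div_iff₀ hh, div_lt_iff₀ hh] at hxa
    exact ⟨hxa.1, by linarith [hxa.2]⟩
  have hcoord : ∀ i, |p i - (a i : ℝ) * 2 ^ l| ≤ 2 ^ l := by
    intro i
    have h1 : (a i : ℝ) * 2 ^ l ≤ sInf ((fun x : EuclideanSpace ℝ (Fin d) => x i) '' X) :=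
      le_csInf (hX.image _) (by rintro _ ⟨x, hx, rfl⟩; exact (hmem x hx i).1)
    have h2 : sSup ((fun x : EuclideanSpace ℝ (Fin d) => x i) '' X) ≤ (a i : ℝ) * 2 ^ l + 2 ^ l :=
      csSup_le (hX.image _) (by rintro _ ⟨x, hx, rfl⟩; exact (hmem x hx i).2)
    have := hp i
    rw [abs_le]
    constructor <;> linarith
  rw [Metric.mem_closedBall, EuclideanSpace.dist_eq]
  refine Real.sqrt_le_iff.mpr ⟨by positivity, ?_⟩
  calc ∑ i, dist (p i) ((a i : ℝ) * 2 ^ l) ^ 2 ≤ ∑ _i : Fin d, ((2 : ℝ) ^ l) ^ 2 := by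
        refine Finset.sum_le_sum fun i _ => ?_
        rw [Real.dist_eq]
        exact pow_le_pow_left₀ (abs_nonneg _) (hcoord i) 2
    _ = d * ((2 : ℝ) ^ l) ^ 2 := by simp
    _ ≤ (d * 2 ^ l) ^ 2 := by
        rw [mul_pow]
        have : (d : ℝ) ≤ (d : ℝ) ^ 2 := by exact_mod_cast Nat.le_self_pow two_ne_zero d
        gcongr

lemma wellSeparated_of_indexFar {s : ℝ} {K : ℕ} (hK : (s + 2) * d ≤ K)
    {S : Finset (EuclideanSpace ℝ (Fin d))} {l : ℤ} {a b : Fin d → ℤ} (hab : IndexFar K a b)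
    {X Y : Set (EuclideanSpace ℝ (Fin d))} (hX : X.Nonempty) (hY : Y.Nonempty)
    (hXa : X ⊆ gridCell S l a) (hYb : Y ⊆ gridCell S l b) : WellSeparated s X Y := by
  refine ⟨_, _, d * 2 ^ l, by positivity, boundingBox_gridCell_subset hX hXa,
    boundingBox_gridCell_subset hY hYb, fun x hx y hy => ?_⟩
  obtain ⟨i, hi⟩ := hab
  have hh : (0 : ℝ) < 2 ^ l := by positivity
  set ca : EuclideanSpace ℝ (Fin d) := WithLp.toLp 2 fun i => (a i : ℝ) * 2 ^ l with hca
  set cb : EuclideanSpace ℝ (Fin d) := WithLp.toLp 2 fun i => (b i : ℝ) * 2 ^ l with hcb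
  have hc : (K : ℝ) * 2 ^ l ≤ dist ca cb := by
    have h1 : ‖(ca - cb) i‖ ≤ dist ca cb := by
      rw [dist_eq_norm]
      exact PiLp.norm_apply_le (ca - cb) i
    have h2 : ‖(ca - cb) i‖ = |(a i : ℝ) - b i| * 2 ^ l := by
      simp only [hca, hcb, PiLp.sub_apply, Real.norm_eq_abs]
      rw [← sub_mul, abs_mul, abs_of_pos hh]
    have h3 : (K : ℝ) ≤ |(a i : ℝ) - b i| := by exact_mod_cast hi.le
    calc (K : ℝ) * 2 ^ l ≤ |(a i : ℝ) - b i| * 2 ^ l := by gcongr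
      _ ≤ _ := h2 ▸ h1
  have hx' : dist ca x ≤ d * 2 ^ l := Metric.mem_closedBall'.mp hx
  have hy' : dist y cb ≤ d * 2 ^ l := Metric.mem_closedBall.mp hy
  have htri := dist_triangle4 ca x y cb
  have := mul_le_mul_of_nonneg_right hK hh.le
  nlinarith

lemma WellSeparated.symm {s : ℝ} {X Y : Set (EuclideanSpace ℝ (Fin d))}
    (h : WellSeparated s X Y) : WellSeparated s Y X := by
  obtain ⟨c₁, c₂, ρ, hρ, hX, hY, hd⟩ := h
  exact ⟨c₂, c₁, ρ, hρ, hY, hX, fun x hx y hy => dist_comm y x ▸ hd y hy x hx⟩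

lemma Lighter.asymm {S : Finset (EuclideanSpace ℝ (Fin d))} {l : ℤ} {a b : Fin d → ℤ}
    (h : Lighter S l a b) : ¬ Lighter S l b a := by
  rintro (h' | ⟨h₁', h₂'⟩) <;> rcases h with h | ⟨h₁, h₂⟩
  · omega
  · omega
  · omega
  · exact lt_asymm h₂ h₂'

lemma lighter_or_lighter {S : Finset (EuclideanSpace ℝ (Fin d))} {l : ℤ} {a b : Fin d → ℤ}
    (h : a ≠ b) : Lighter S l a b ∨ Lighter S l b a := by
  rcases lt_trichotomy (nearCount S l a) (nearCount S l b) with hlt | heq | hgt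
  · exact Or.inl (Or.inl hlt)
  · rcases lt_or_gt_of_ne (toLex.injective.ne h) with hlt | hgt
    · exact Or.inl (Or.inr ⟨heq, hlt⟩)
    · exact Or.inr (Or.inr ⟨heq.symm, hgt⟩)
  · exact Or.inr (Or.inl hgt)

lemma Lighter.nearCount_le {S : Finset (EuclideanSpace ℝ (Fin d))} {l : ℤ} {a b : Fin d → ℤ}
    (h : Lighter S l a b) : nearCount S l a ≤ nearCount S l b :=
  h.elim le_of_lt fun h => h.1.le

lemma IndexFar.ne {K : ℕ} {a b : Fin d → ℤ} (h : IndexFar K a b) : a ≠ b := by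
  rintro rfl
  obtain ⟨i, hi⟩ := h
  simp at hi
  omega

lemma pays_or_pays {K : ℕ} (hK : 1 ≤ K) (S : Finset (EuclideanSpace ℝ (Fin d)))
    {p q : EuclideanSpace ℝ (Fin d)} (hpq : p ≠ q) : Pays K S p q ∨ Pays K S q p := by
  rw [Pays, Pays, sepLevel_comm K q p]
  exact lighter_or_lighter (isSepLevel_sepLevel hK hpq).1.ne

lemma Pays.asymm {K : ℕ} {S : Finset (EuclideanSpace ℝ (Fin d))}
    {p q : EuclideanSpace ℝ (Fin d)} (h : Pays K S p q) : ¬ Pays K S q p := by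
  rw [Pays, sepLevel_comm K q p]
  exact Lighter.asymm h

lemma pays_and_cellPair_eq_of_mem {K : ℕ} (hK : 1 ≤ K) {S : Finset (EuclideanSpace ℝ (Fin d))}
    {p q q' : EuclideanSpace ℝ (Fin d)} (hpq : p ≠ q) (h : Pays K S p q)
    (hq : q' ∈ gridCell S (sepLevel K p q) (gridIndex (sepLevel K p q) q)) :
    Pays K S p q' ∧ cellPair K S p q = cellPair K S p q' := by
  have hl := sepLevel_eq_of_gridIndex_eq hK hpq hq.2
  refine ⟨?_, ?_⟩
  · rw [Pays, hl, hq.2]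
    exact h
  · rw [cellPair, cellPair, hl, hq.2]

lemma isWSPD_singletonDecomposition {s : ℝ} {K : ℕ} (hK : 1 ≤ K) (hsK : (s + 2) * d ≤ K)
    (S : Finset (EuclideanSpace ℝ (Fin d))) : IsWSPD s S (singletonDecomposition K S) := by
  refine ⟨?_, ?_⟩
  · intro e he X Y hXY
    obtain ⟨p, hp, q, hq, hne, -, rfl⟩ := mem_singletonDecomposition.mp he
    have hsub : gridCell S (sepLevel K p q) (gridIndex (sepLevel K p q) q) ⊆ ↑S :=
      fun x hx => hx.1
    have hnon : (gridCell S (sepLevel K p q) (gridIndex (sepLevel K p q) q)).Nonempty :=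
      ⟨q, hq, rfl⟩
    have hws : WellSeparated s {p}
        (gridCell S (sepLevel K p q) (gridIndex (sepLevel K p q) q)) :=
      wellSeparated_of_indexFar hsK (isSepLevel_sepLevel hK hne).1 (Set.singleton_nonempty p)
        hnon (Set.singleton_subset_iff.mpr ⟨hp, rfl⟩) subset_rfl
    rcases Sym2.eq_iff.mp hXY with ⟨rfl, rfl⟩ | ⟨rfl, rfl⟩
    · exact ⟨Set.singleton_nonempty p, hnon, by simpa using hp, hsub, hws⟩
    · exact ⟨hnon, Set.singleton_nonempty p, hsub, by simpa using hp, hws.symm⟩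
  · intro p hp q hq hpq
    have hcases : ∀ e ∈ singletonDecomposition K S,
        (∃ X Y : Set (EuclideanSpace ℝ (Fin d)), e = s(X, Y) ∧ p ∈ X ∧ q ∈ Y) →
        (Pays K S p q ∧ e = cellPair K S p q) ∨ (Pays K S q p ∧ e = cellPair K S q p) := by
      rintro e he ⟨X, Y, hXY, hpX, hqY⟩
      obtain ⟨p', -, q', -, hne, hpay, rfl⟩ := mem_singletonDecomposition.mp he
      rcases Sym2.eq_iff.mp hXY with ⟨rfl, rfl⟩ | ⟨rfl, rfl⟩
      · obtain rfl : p = p' := hpX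
        exact Or.inl (pays_and_cellPair_eq_of_mem hK hne hpay hqY)
      · obtain rfl : q = p' := hqY
        exact Or.inr (pays_and_cellPair_eq_of_mem hK hne hpay hpX)
    rcases pays_or_pays hK S hpq with h | h
    · refine ⟨cellPair K S p q, ⟨mem_singletonDecomposition.mpr ⟨p, hp, q, hq, hpq, h, rfl⟩,
        _, _, rfl, rfl, hq, rfl⟩, fun e he => ?_⟩
      rcases hcases e he.1 he.2 with h' | h'
      · exact h'.2
      · exact absurd h'.1 h.asymm
    · refine ⟨cellPair K S q p, ⟨mem_singletonDecomposition.mpr ⟨q, hq, p, hp, hpq.symm, h, rfl⟩,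
        _, _, Sym2.eq_swap, ⟨hp, rfl⟩, rfl⟩, fun e he => ?_⟩
      rcases hcases e he.1 he.2 with h' | h'
      · exact absurd h'.1 h.asymm
      · exact h'.2

lemma IsSepLevel.abs_sub_le {K : ℕ} {l : ℤ} {p q : EuclideanSpace ℝ (Fin d)}
    (h : IsSepLevel K l p q) (i : Fin d) :
    |gridIndex l p i - gridIndex l q i| ≤ 2 * K + 1 := by
  have h2 := h.2
  simp only [IndexFar, not_exists, not_lt] at h2
  have hi := h2 i
  rw [gridIndex_add_one, gridIndex_add_one] at hi
  rw [abs_le] at hi ⊢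
  omega

lemma abs_ediv_sub_ediv_le_one {a b m : ℤ} (hm : 0 < m) (h : |a - b| ≤ m) :
    |a / m - b / m| ≤ 1 := by
  have h1 : (a + m) / m = a / m + 1 := by
    simpa using Int.add_mul_ediv_right a 1 hm.ne'
  have h2 : (b + m) / m = b / m + 1 := by
    simpa using Int.add_mul_ediv_right b 1 hm.ne'
  rw [abs_le] at h ⊢
  have h3 : a / m ≤ (b + m) / m := Int.ediv_le_ediv hm (by omega)
  have h4 : b / m ≤ (a + m) / m := Int.ediv_le_ediv hm (by omega)
  omega

lemma nearCount_le_card (S : Finset (EuclideanSpace ℝ (Fin d))) (l : ℤ) (a : Fin d → ℤ) :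
    nearCount S l a ≤ S.card :=
  Finset.card_filter_le _ _

lemma nearCount_pos {S : Finset (EuclideanSpace ℝ (Fin d))} {p : EuclideanSpace ℝ (Fin d)}
    (hp : p ∈ S) (l : ℤ) : 0 < nearCount S l (gridIndex l p) :=
  Finset.card_pos.mpr ⟨p, by simp [hp]⟩

lemma nearCount_monotone (S : Finset (EuclideanSpace ℝ (Fin d)))
    (p : EuclideanSpace ℝ (Fin d)) : Monotone fun l => nearCount S l (gridIndex l p) := by
  classical
  refine monotone_int_of_le_succ fun l => Finset.card_le_card fun x hx => ?_
  simp only [Finset.mem_filter] at hx ⊢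
  refine ⟨hx.1, fun i => ?_⟩
  rw [gridIndex_add_one, gridIndex_add_one]
  exact abs_ediv_sub_ediv_le_one two_pos ((hx.2 i).trans one_le_two)

lemma two_mul_nearCount_le {K : ℕ} (hK : 2 ≤ K) {S : Finset (EuclideanSpace ℝ (Fin d))}
    {p q : EuclideanSpace ℝ (Fin d)} (hpq : p ≠ q) (h : Pays K S p q) :
    2 * nearCount S (sepLevel K p q) (gridIndex (sepLevel K p q) p) ≤
      nearCount S (sepLevel K p q + (2 * K + 2 : ℕ))
        (gridIndex (sepLevel K p q + (2 * K + 2 : ℕ)) p) := by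
  classical
  have hsep := isSepLevel_sepLevel (by omega : 1 ≤ K) hpq
  have hle := Lighter.nearCount_le h
  generalize sepLevel K p q = l at hsep hle
  have hpow : (2 * K + 2 : ℤ) ≤ 2 ^ (2 * K + 2) := by
    exact_mod_cast (Nat.lt_two_pow_self (n := 2 * K + 2)).le
  have hdisj : Disjoint (S.filter fun x => ∀ i, |gridIndex l x i - gridIndex l p i| ≤ 1)
      (S.filter fun x => ∀ i, |gridIndex l x i - gridIndex l q i| ≤ 1) := by
    rw [Finset.disjoint_left]
    intro x hx hx'
    obtain ⟨i, hi⟩ := hsep.1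
    have h1 := (Finset.mem_filter.mp hx).2 i
    have h2 := (Finset.mem_filter.mp hx').2 i
    rw [abs_le] at h1 h2
    rw [lt_abs] at hi
    omega
  calc 2 * nearCount S l (gridIndex l p)
      ≤ nearCount S l (gridIndex l p) + nearCount S l (gridIndex l q) := by omega
    _ = ((S.filter fun x => ∀ i, |gridIndex l x i - gridIndex l p i| ≤ 1) ∪
          (S.filter fun x => ∀ i, |gridIndex l x i - gridIndex l q i| ≤ 1)).card := by
        rw [Finset.card_union_of_disjoint hdisj, nearCount, nearCount]
    _ ≤ _ := by
        refine Finset.card_le_card fun x hx => ?_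
        rw [Finset.mem_union, Finset.mem_filter, Finset.mem_filter] at hx
        have hxS : x ∈ S := hx.elim And.left And.left
        refine Finset.mem_filter.mpr ⟨hxS, fun i => ?_⟩
        rw [gridIndex_add_natCast, gridIndex_add_natCast]
        refine abs_ediv_sub_ediv_le_one (by positivity) (le_trans ?_ hpow)
        have hd := hsep.abs_sub_le i
        rw [abs_le] at hd ⊢
        rcases hx with hx | hx
        · have := hx.2 i
          rw [abs_le] at this
          omega
        · have := hx.2 i
          rw [abs_le] at this
          omega

end Grid

/-- A monotone function with values in `[1, n]` doubles over at most `c * (log₂ n + 1)` windows of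
length `c`. -/
lemma card_le_of_doubling {N : ℤ → ℕ} (hN : Monotone N) (hpos : ∀ l, 0 < N l) {n c : ℕ}
    (hn : ∀ l, N l ≤ n) (hc : 0 < c) (L : Finset ℤ) (hL : ∀ l ∈ L, 2 * N l ≤ N (l + c)) :
    L.card ≤ c * (Nat.log 2 n + 1) := by
  have key : ∀ l ∈ L, ∀ l', l < l' → l % c = l' % c → Nat.log 2 (N l) < Nat.log 2 (N l') := by
    intro l hl l' hlt hmod
    have hdvd : (c : ℤ) ∣ l' - l := Int.ModEq.dvd hmod
    have hle : (c : ℤ) ≤ l' - l := Int.le_of_dvd (by omega) hdvd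
    have h1 : 2 * N l ≤ N l' := (hL l hl).trans (hN (by omega))
    calc Nat.log 2 (N l) < Nat.log 2 (N l * 2) := by
          rw [Nat.log_mul_base one_lt_two (hpos l).ne']
          exact Nat.lt_succ_self _
      _ ≤ Nat.log 2 (N l') := Nat.log_mono_right (by omega)
  have hc' : (0 : ℤ) < c := by exact_mod_cast hc
  have hcard := Finset.card_le_card_of_injOn (s := L)
    (t := Finset.range c ×ˢ Finset.range (Nat.log 2 n + 1))
    (fun l => ((l % c).toNat, Nat.log 2 (N l))) ?_ ?_
  · simpa using hcard
  · intro l _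
    have h1 := Int.emod_nonneg l hc'.ne'
    have h2 := Int.emod_lt_of_pos l hc'
    have h3 : Nat.log 2 (N l) ≤ Nat.log 2 n := Nat.log_mono_right (hn l)
    simp only [Finset.coe_product, Set.mem_prod, Finset.coe_range, Set.mem_Iio]
    omega
  · intro l hl l' hl' heq
    obtain ⟨h1, h2⟩ := Prod.mk.inj heq
    have h3 := Int.emod_nonneg l hc'.ne'
    have h4 := Int.emod_nonneg l' hc'.ne'
    have hmod : l % c = l' % c := by omega
    rcases lt_trichotomy l l' with hlt | h | hlt
    · exact absurd h2 (key l hl l' hlt hmod).ne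
    · exact h
    · exact absurd h2 (key l' hl' l hlt hmod.symm).ne'

lemma card_singletonDecomposition_le {d K : ℕ} (hK : 2 ≤ K)
    (S : Finset (EuclideanSpace ℝ (Fin d))) :
    (singletonDecomposition K S).card ≤
      S.card * ((2 * K + 2) * (Nat.log 2 S.card + 1) * (4 * K + 3) ^ d) := by
  classical
  let L : EuclideanSpace ℝ (Fin d) → Finset ℤ := fun p =>
    (S.filter fun q => p ≠ q ∧ Pays K S p q).image (sepLevel K p)
  let O : Finset (Fin d → ℤ) := Fintype.piFinset fun _ => Finset.Icc (-(2 * K + 1 : ℤ)) (2 * K + 1)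
  have hsub : singletonDecomposition K S ⊆ S.biUnion fun p =>
      (L p ×ˢ O).image fun z => s({p}, gridCell S z.1 (gridIndex z.1 p + z.2)) := by
    intro e he
    obtain ⟨p, hp, q, hq, hne, hpay, rfl⟩ := mem_singletonDecomposition.mp he
    refine Finset.mem_biUnion.mpr ⟨p, hp, Finset.mem_image.mpr
      ⟨(sepLevel K p q, gridIndex (sepLevel K p q) q - gridIndex (sepLevel K p q) p),
        Finset.mem_product.mpr ⟨Finset.mem_image.mpr ⟨q, by simp [hq, hne, hpay], rfl⟩, ?_⟩, ?_⟩⟩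
    · refine Fintype.mem_piFinset.mpr fun i => ?_
      have := (isSepLevel_sepLevel (by omega : 1 ≤ K) hne).abs_sub_le i
      rw [abs_le] at this
      simp only [Finset.mem_Icc, Pi.sub_apply]
      omega
    · simp [cellPair]
  refine (Finset.card_le_card hsub).trans (Finset.card_biUnion_le_card_mul _ _ _ fun p hp => ?_)
  refine Finset.card_image_le.trans ?_
  rw [Finset.card_product]
  have hO : O.card = (4 * K + 3) ^ d := by
    simp only [O, Fintype.card_piFinset, Int.card_Icc, Finset.prod_const, Finset.card_univ,
      Fintype.card_fin]
    congr 1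
    omega
  rw [hO]
  refine Nat.mul_le_mul_right _ (card_le_of_doubling (nearCount_monotone S p) (nearCount_pos hp)
    (fun l => nearCount_le_card S l _) (by omega) _ fun l hl => ?_)
  obtain ⟨q, hq, rfl⟩ := Finset.mem_image.mp hl
  obtain ⟨-, hne, hpay⟩ := Finset.mem_filter.mp hq
  exact two_mul_nearCount_le hK hne hpay

/-- For every dimension `d ≥ 1` and every `s > 0` there is a constant `C` such
that every set `S` of `n ≥ 2` points in `ℝ^d` admits a WSPD with separation
constant `s` consisting of at most `C·n·log₂ n` pairs, in which every pair has
a singleton side. -/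
theorem wspd_singleton_size (d : ℕ) (hd : 1 ≤ d) (s : ℝ) (hs : 0 < s) :
    ∃ C : ℝ, ∀ S : Finset (EuclideanSpace ℝ (Fin d)), 2 ≤ S.card →
      ∃ W : Finset (Sym2 (Set (EuclideanSpace ℝ (Fin d)))),
        IsWSPD s S W ∧
        (W.card : ℝ) ≤ C * S.card * Real.logb 2 S.card ∧
        ∀ e ∈ W, ∀ X Y : Set (EuclideanSpace ℝ (Fin d)), e = s(X, Y) →
          (∃ x, X = {x}) ∨ (∃ y, Y = {y}) := by
  obtain ⟨K, hK⟩ := exists_nat_ge (max ((s + 2) * d) 2)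
  have hsK : (s + 2) * d ≤ K := (le_max_left _ _).trans hK
  have hK2 : 2 ≤ K := by exact_mod_cast (le_max_right _ _).trans hK
  refine ⟨2 * ((2 * K + 2) * (4 * K + 3) ^ d), fun S hS => ⟨singletonDecomposition K S,
    isWSPD_singletonDecomposition (by omega) hsK S, ?_, ?_⟩⟩
  · have hcard : ((singletonDecomposition K S).card : ℝ) ≤
        S.card * ((2 * K + 2) * (Nat.log 2 S.card + 1) * (4 * K + 3) ^ d) := by
      exact_mod_cast card_singletonDecomposition_le hK2 S
    have hlog : (Nat.log 2 S.card : ℝ) ≤ Real.logb 2 S.card := by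
      exact_mod_cast Real.natLog_le_logb S.card 2
    have hone : (1 : ℝ) ≤ Nat.log 2 S.card := by
      exact_mod_cast Nat.log_pos one_lt_two hS
    calc ((singletonDecomposition K S).card : ℝ)
        ≤ S.card * ((2 * K + 2) * (Nat.log 2 S.card + 1) * (4 * K + 3) ^ d) := hcard
      _ ≤ S.card * ((2 * K + 2) * (2 * Real.logb 2 S.card) * (4 * K + 3) ^ d) := by
          gcongr
          linarith
      _ = _ := by ring
  · intro e he X Y hXY
    obtain ⟨p, -, q, -, -, -, rfl⟩ := mem_singletonDecomposition.mp he
    rcases Sym2.eq_iff.mp hXY with ⟨rfl, rfl⟩ | ⟨rfl, rfl⟩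
    · exact Or.inl ⟨p, rfl⟩
    · exact Or.inr ⟨p, rfl⟩
end

section
/- Let d ≥ 1 be an integer, let s > 0 be a real number, let μ = ⌈log₂(√d·(1 + 4/s))⌉ + 1, and let k ≥ 0 be an integer. Let ℓ_0, …, ℓ_k and a_0, …, a_k be nonnegative real numbers satisfying: (i) a_i ≤ (2/s)·ℓ_i for all 0 ≤ i ≤ k; (ii) a_i ≤ (1/2)·a_{i+d} for all 0 ≤ i ≤ k − d; (iii) ℓ_i ≤ (√d·(s+4)/2)·a_{i+1} for all 0 ≤ i ≤ k − 1; and (iv) a_i ≤ a_j whenever 0 ≤ i ≤ j ≤ k. Then Σ_{i=0}^{k} ℓ_i ≤ 2·√d·(μ·d + 1)·(1 + 4/s)·ℓ_k. -/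
/-- A nonnegative monotone sequence that at least doubles every `d` steps has partial sums bounded
by `2 * d` times the last term. -/
theorem sum_range_succ_le_of_two_mul_le {a : ℕ → ℝ} {d k : ℕ} (hd : 1 ≤ d)
    (ha0 : ∀ i ≤ k, 0 ≤ a i)
    (h2 : ∀ i, i + d ≤ k → a i ≤ (1 / 2) * a (i + d))
    (h4 : ∀ i j, i ≤ j → j ≤ k → a i ≤ a j) :
    ∀ m ≤ k, ∑ i ∈ Finset.range (m + 1), a i ≤ 2 * d * a m := by
  intro m
  induction m using Nat.strong_induction_on with
  | _ m ih =>
    intro hm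
    have ham := ha0 m hm
    rcases lt_or_ge m d with hlt | hge
    · have hsum : ∑ i ∈ Finset.range (m + 1), a i ≤ ((m + 1 : ℕ) : ℝ) * a m := by
        simpa using Finset.sum_le_card_nsmul (Finset.range (m + 1)) a (a m)
          fun i hi => h4 i m (Nat.lt_succ_iff.mp (Finset.mem_range.mp hi)) hm
      have hmd : ((m + 1 : ℕ) : ℝ) ≤ d := by exact_mod_cast hlt
      nlinarith [mul_le_mul_of_nonneg_right hmd ham, mul_nonneg (Nat.cast_nonneg (α := ℝ) d) ham]
    · obtain ⟨n, rfl⟩ := Nat.exists_eq_add_of_le' hge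
      have hlast : ∑ i ∈ Finset.range d, a (n + 1 + i) ≤ d * a (n + d) := by
        simpa using Finset.sum_le_card_nsmul (Finset.range d) (fun i => a (n + 1 + i)) (a (n + d))
          fun i hi => h4 _ _ (by have := Finset.mem_range.mp hi; omega) hm
      have hfirst := ih n (by omega) (by omega)
      have hdouble := mul_le_mul_of_nonneg_left (h2 n hm) (Nat.cast_nonneg (α := ℝ) d)
      rw [show n + d + 1 = n + 1 + d by ring, Finset.sum_range_add]
      linarith


/-- Lemma on the lengths `ℓ_i` and box sizes `a_i` along a path of `c`-nodes:
under the stated recurrences, `Σ_{i=0}^{k} ℓ_i ≤ 2·√d·(μ·d + 1)·(1 + 4/s)·ℓ_k`,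
where `μ = ⌈log₂(√d·(1 + 4/s))⌉ + 1`. -/
theorem sum_ell_le (d : ℕ) (hd : 1 ≤ d) (s : ℝ) (hs : 0 < s) (k : ℕ)
    (ℓ a : ℕ → ℝ)
    (hℓ0 : ∀ i ≤ k, 0 ≤ ℓ i) (ha0 : ∀ i ≤ k, 0 ≤ a i)
    (h1 : ∀ i ≤ k, a i ≤ (2 / s) * ℓ i)
    (h2 : ∀ i, i + d ≤ k → a i ≤ (1 / 2) * a (i + d))
    (h3 : ∀ i, i + 1 ≤ k → ℓ i ≤ (Real.sqrt d * (s + 4) / 2) * a (i + 1))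
    (h4 : ∀ i j, i ≤ j → j ≤ k → a i ≤ a j) :
    ∑ i ∈ Finset.range (k + 1), ℓ i ≤
      2 * Real.sqrt d *
        (((⌈Real.logb 2 (Real.sqrt d * (1 + 4 / s))⌉ + 1 : ℤ) : ℝ) * d + 1) *
        (1 + 4 / s) * ℓ k := by
  have hd' : (1 : ℝ) ≤ d := by exact_mod_cast hd
  have hsqrt : 1 ≤ Real.sqrt d := Real.one_le_sqrt.mpr hd'
  have hs4 : 0 < 4 / s := by positivity
  set C := Real.sqrt d * (1 + 4 / s) with hC
  have hC1 : 1 ≤ C := one_le_mul_of_one_le_of_one_le hsqrt (by linarith)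
  have hμ : (1 : ℝ) ≤ ((⌈Real.logb 2 C⌉ + 1 : ℤ) : ℝ) := by
    have : 0 ≤ ⌈Real.logb 2 C⌉ := Int.ceil_nonneg (Real.logb_nonneg one_lt_two hC1)
    exact_mod_cast (by omega : (1 : ℤ) ≤ ⌈Real.logb 2 C⌉ + 1)
  generalize ((⌈Real.logb 2 C⌉ + 1 : ℤ) : ℝ) = μ at hμ ⊢
  have hℓk := hℓ0 k le_rfl
  have hfactor : 0 ≤ Real.sqrt d * (s + 4) / 2 := by positivity
  have hsum : ∑ i ∈ Finset.range k, ℓ i ≤ 2 * d * C * ℓ k := by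
    calc ∑ i ∈ Finset.range k, ℓ i
        ≤ ∑ i ∈ Finset.range k, (Real.sqrt d * (s + 4) / 2) * a (i + 1) :=
          Finset.sum_le_sum fun i hi => h3 i (Finset.mem_range.mp hi)
      _ = (Real.sqrt d * (s + 4) / 2) * ∑ i ∈ Finset.range k, a (i + 1) := by
          rw [Finset.mul_sum]
      _ ≤ (Real.sqrt d * (s + 4) / 2) * (2 * d * ((2 / s) * ℓ k)) := by
          refine mul_le_mul_of_nonneg_left ?_ hfactor
          have htotal := sum_range_succ_le_of_two_mul_le hd ha0 h2 h4 k le_rfl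
          rw [Finset.sum_range_succ'] at htotal
          have hak := mul_le_mul_of_nonneg_left (h1 k le_rfl)
            (by positivity : (0 : ℝ) ≤ 2 * d)
          linarith [ha0 0 (Nat.zero_le k)]
      _ = 2 * d * C * ℓ k := by
          rw [hC]
          field_simp
  have hCℓ : ℓ k ≤ C * ℓ k := le_mul_of_one_le_left hℓk hC1
  have hμd : (d : ℝ) ≤ μ * d := le_mul_of_one_le_left (by linarith) hμ
  have hmain := mul_le_mul_of_nonneg_right hμd (hℓk.trans hCℓ)
  rw [Finset.sum_range_succ]
  calc ∑ i ∈ Finset.range k, ℓ i + ℓ k ≤ 2 * (μ * d + 1) * (C * ℓ k) := by linarith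
    _ = 2 * Real.sqrt d * (μ * d + 1) * (1 + 4 / s) * ℓ k := by rw [hC]; ring
end

section
/- Let d ≥ 1 be an integer, let s > 0 be a real number, and let k ≥ 0 be an integer. Let ℓ_0, …, ℓ_k and a_0, …, a_k be nonnegative real numbers satisfying: (i) a_i ≤ (2/s)·ℓ_i for all 0 ≤ i ≤ k; (ii) a_i ≤ (1/2)·a_{i+d} for all 0 ≤ i ≤ k − d; and (iii) ℓ_i ≤ (√d·(s+4)/2)·a_{i+1} for all 0 ≤ i ≤ k − 1. Then for all integers i ≥ 0 and j ≥ 0 with i + 1 + j·d ≤ k, we have ℓ_i ≤ √d·(1 + 4/s)·(1/2)^j·ℓ_{i+1+jd}. In particular, with μ = ⌈log₂(√d·(1 + 4/s))⌉ + 1, we have ℓ_i ≤ (1/2)·ℓ_{i+1+μd} whenever i + 1 + μ·d ≤ k. -/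
/-- Iterating `a i ≤ a (i + d) / 2` along `j` steps of length `d`. -/
theorem le_half_pow_mul_of_le_half_mul {a : ℕ → ℝ} {d k : ℕ}
    (h : ∀ i, i + d ≤ k → a i ≤ (1 / 2) * a (i + d)) (i j : ℕ) (hij : i + j * d ≤ k) :
    a i ≤ (1 / 2) ^ j * a (i + j * d) := by
  induction j with
  | zero => simp
  | succ j ih =>
    have hidx : i + (j + 1) * d = i + j * d + d := by ring
    rw [hidx] at hij ⊢
    calc a i ≤ (1 / 2) ^ j * a (i + j * d) := ih (by omega)
      _ ≤ (1 / 2) ^ j * ((1 / 2) * a (i + j * d + d)) := by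
        gcongr
        exact h _ hij
      _ = (1 / 2) ^ (j + 1) * a (i + j * d + d) := by ring

/-- Halving `⌈log₂ C⌉ + 1` times brings a positive `C` down to at most `1 / 2`. -/
theorem mul_half_pow_ceil_logb_le {C : ℝ} (hC : 0 < C) :
    C * (1 / 2) ^ (⌈Real.logb 2 C⌉ + 1).toNat ≤ 1 / 2 := by
  set m := (⌈Real.logb 2 C⌉ + 1).toNat
  have hm : Real.logb 2 (2 * C) ≤ m := by
    have hcast : ((⌈Real.logb 2 C⌉ + 1 : ℤ) : ℝ) ≤ m := by
      exact_mod_cast Int.self_le_toNat (⌈Real.logb 2 C⌉ + 1)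
    rw [Real.logb_mul two_ne_zero hC.ne', Real.logb_self_eq_one one_lt_two]
    push_cast at hcast
    linarith [Int.le_ceil (Real.logb 2 C)]
  rw [Real.logb_le_iff_le_rpow one_lt_two (by positivity), Real.rpow_natCast] at hm
  rw [one_div, inv_pow, ← div_eq_mul_inv, div_le_iff₀ (by positivity)]
  linarith


/-- Under the stated recurrences for `ℓ_i` and `a_i`, for all `i, j ≥ 0` with
`i + 1 + j·d ≤ k` one has `ℓ_i ≤ √d·(1 + 4/s)·(1/2)^j·ℓ_{i+1+jd}`; in
particular, with `μ = ⌈log₂(√d·(1 + 4/s))⌉ + 1`, `ℓ_i ≤ (1/2)·ℓ_{i+1+μd}`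
whenever `i + 1 + μ·d ≤ k`. -/
theorem ell_geometric_growth (d : ℕ) (hd : 1 ≤ d) (s : ℝ) (hs : 0 < s) (k : ℕ)
    (ℓ a : ℕ → ℝ)
    (hℓ0 : ∀ i ≤ k, 0 ≤ ℓ i) (ha0 : ∀ i ≤ k, 0 ≤ a i)
    (h1 : ∀ i ≤ k, a i ≤ (2 / s) * ℓ i)
    (h2 : ∀ i, i + d ≤ k → a i ≤ (1 / 2) * a (i + d))
    (h3 : ∀ i, i + 1 ≤ k → ℓ i ≤ (Real.sqrt d * (s + 4) / 2) * a (i + 1)) :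
    (∀ i j : ℕ, i + 1 + j * d ≤ k →
        ℓ i ≤ Real.sqrt d * (1 + 4 / s) * (1 / 2) ^ j * ℓ (i + 1 + j * d)) ∧
    (∀ i : ℕ, i + 1 + (⌈Real.logb 2 (Real.sqrt d * (1 + 4 / s))⌉ + 1).toNat * d ≤ k →
        ℓ i ≤ (1 / 2) *
          ℓ (i + 1 + (⌈Real.logb 2 (Real.sqrt d * (1 + 4 / s))⌉ + 1).toNat * d)) := by
  have hbound : ∀ i j : ℕ, i + 1 + j * d ≤ k →
      ℓ i ≤ Real.sqrt d * (1 + 4 / s) * (1 / 2) ^ j * ℓ (i + 1 + j * d) := by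
    intro i j hij
    calc ℓ i ≤ (Real.sqrt d * (s + 4) / 2) * a (i + 1) := h3 i (by omega)
      _ ≤ (Real.sqrt d * (s + 4) / 2) * ((1 / 2) ^ j * ((2 / s) * ℓ (i + 1 + j * d))) := by
        gcongr
        exact (le_half_pow_mul_of_le_half_mul h2 (i + 1) j hij).trans (by gcongr; exact h1 _ hij)
      _ = Real.sqrt d * (1 + 4 / s) * (1 / 2) ^ j * ℓ (i + 1 + j * d) := by
        field_simp
  refine ⟨hbound, fun i hi => (hbound i _ hi).trans ?_⟩
  have hd' : (0 : ℝ) < d := by exact_mod_cast hd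
  exact mul_le_mul_of_nonneg_right (mul_half_pow_ceil_logb_le (by positivity)) (hℓ0 _ hi)
end
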